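/- Let G be a δ-hyperbolic group, let C₀ ≥ 14δ and C₁ > 12(C₀ + δ), and let X₀, X₁, …, X_n ∈ G satisfy d(X_{i−1},X_i) > C₁ for all i = 1,…,n and (X_{i−1}|X_{i+1})_{X_i} ≤ C₀ for all i = 1,…,n−1. Then d(X₀,X_n) ≥ ½ · Σ_{i=1}^{n} d(X_{i−1},X_i). -/

import Mathlib

open Pointwise

section WordMetric

variable {G : Type*} [Group G]

/-- The word length of `g` with respect to a generating set `S`: the length of a shortest
word in the letters of `S` representing `g`. -/
noncomputable def wordLength (S : Set G) (g : G) : ℕ :=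
  sInf {n | ∃ l : List G, (∀ s ∈ l, s ∈ S) ∧ l.prod = g ∧ l.length = n}

/-- The word metric `d(x, y) = |x⁻¹ y|` associated with the generating set `S`,
viewed as a real number. -/
noncomputable def wdist (S : Set G) (x y : G) : ℝ :=
  (wordLength S (x⁻¹ * y) : ℝ)

/-- The Gromov product `(x|y)_w = ½ (d(x,w) + d(y,w) − d(x,y))`. -/
noncomputable def gromovProd (S : Set G) (x y w : G) : ℝ :=
  (wdist S x w + wdist S y w - wdist S x y) / 2

/-- `z` lies between `x` and `y`: `d(x,z) + d(z,y) = d(x,y)`. -/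
def LiesBetween (S : Set G) (x z y : G) : Prop :=
  wdist S x z + wdist S z y = wdist S x y

/-- `G` is `δ`-hyperbolic with respect to the word metric of `S`:
(i) the Gromov products satisfy the `δ`-inequality; (ii) triangles are `δ`-thin;
(iii) triangles are `δ`-slim. -/
def IsHyperbolicWith (S : Set G) (δ : ℝ) : Prop :=
  (∀ x y z w : G,
      gromovProd S x y w ≥ min (gromovProd S x z w) (gromovProd S y z w) - δ) ∧
  (∀ x y z p q : G, LiesBetween S x p y → LiesBetween S x q z →
      wdist S x p = wdist S x q → wdist S x p ≤ gromovProd S y z x →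
      wdist S p q ≤ δ) ∧
  (∀ x y z p : G, LiesBetween S x p y →
      ∃ q : G, (LiesBetween S x q z ∨ LiesBetween S z q y) ∧ wdist S p q ≤ δ)

/-- A subset `Q ⊆ G` is `ε`-quasiconvex: every point between two points of `Q`
is at distance at most `ε` from `Q`. -/
def IsEpsQuasiconvex (S : Set G) (ε : ℝ) (Q : Set G) : Prop :=
  ∀ x ∈ Q, ∀ y ∈ Q, ∀ z : G, LiesBetween S x z y → ∃ q ∈ Q, wdist S z q ≤ ε

/-- A subset `Q ⊆ G` is quasiconvex if it is `ε`-quasiconvex for some `ε ≥ 0`. -/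
def IsQuasiconvex (S : Set G) (Q : Set G) : Prop :=
  ∃ ε : ℝ, 0 ≤ ε ∧ IsEpsQuasiconvex S ε Q

/-- For subsets `B A` of a group `G`, `Prec B A` means `B ⪯ A`: there exist finitely many
elements `x₁, …, xₙ ∈ G` with `B ⊆ A x₁ ∪ ⋯ ∪ A xₙ`. -/
def Prec (B A : Set G) : Prop :=
  ∃ T : Finset G, B ⊆ A * (T : Set G)

/-- `A ≈ B` : `A ⪯ B` and `B ⪯ A`. -/
def Approx (A B : Set G) : Prop :=
  Prec A B ∧ Prec B A

/-- A subset `A` is quasidense if `G ⪯ A`. -/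
def Quasidense (A : Set G) : Prop :=
  Prec (Set.univ : Set G) A

/-- The conjugate subgroup `gHg⁻¹`. -/
def conjSubgroup (g : G) (H : Subgroup G) : Subgroup G :=
  H.map (MulAut.conj g).toMonoidHom

/-- `H^G = {g h g⁻¹ : h ∈ H, g ∈ G}`, the union of all conjugates of `H`. -/
def conjUnion (H : Subgroup G) : Set G :=
  {x | ∃ g : G, ∃ h ∈ H, x = g * h * g⁻¹}

/-- The quasiconvex product `f₀ G₁ f₁ G₂ ⋯ f_{n−1} G_n f_n` determined by the subgroups
`H 0, …, H (n-1)` and the elements `f 0, …, f n`. -/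
def quasiconvexProduct (n : ℕ) (f : Fin (n + 1) → G) (H : Fin n → Subgroup G) : Set G :=
  {x | ∃ g : Fin n → G, (∀ i, g i ∈ H i) ∧
        x = f 0 * (List.ofFn fun i : Fin n => g i * f i.succ).prod}

end WordMetric

theorem wordLength_inv_le {G : Type*} [Group G] {S : Set G} (hSsym : ∀ s ∈ S, s⁻¹ ∈ S)
    (hSgen : Subgroup.closure S = ⊤) (g : G) : wordLength S g⁻¹ ≤ wordLength S g := by
  have hne : {n | ∃ l : List G, (∀ s ∈ l, s ∈ S) ∧ l.prod = g ∧ l.length = n}.Nonempty := by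
    have hg : g ∈ (Subgroup.closure S).toSubmonoid := by simp [hSgen]
    rw [Subgroup.closure_toSubmonoid] at hg
    obtain ⟨l, hl, hprod⟩ := Submonoid.exists_list_of_mem_closure hg
    refine ⟨l.length, l, fun s hs => ?_, hprod, rfl⟩
    rcases hl s hs with h | h
    · exact h
    · simpa using hSsym _ h
  obtain ⟨l, hl, hprod, hlen⟩ := Nat.sInf_mem hne
  refine Nat.sInf_le ⟨(l.map (·⁻¹)).reverse, fun s hs => ?_, ?_, ?_⟩
  · simp only [List.mem_reverse, List.mem_map] at hs
    obtain ⟨t, ht, rfl⟩ := hs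
    exact hSsym t (hl t ht)
  · rw [← List.prod_inv_reverse, hprod]
  · simpa [wordLength] using hlen

theorem wdist_comm {G : Type*} [Group G] {S : Set G} (hSsym : ∀ s ∈ S, s⁻¹ ∈ S)
    (hSgen : Subgroup.closure S = ⊤) (x y : G) : wdist S x y = wdist S y x := by
  have h : wordLength S (x⁻¹ * y) = wordLength S (y⁻¹ * x) := by
    apply le_antisymm
    · simpa using wordLength_inv_le hSsym hSgen (y⁻¹ * x)
    · simpa using wordLength_inv_le hSsym hSgen (x⁻¹ * y)
  simp only [wdist, h]

theorem wdist_self {G : Type*} [Group G] (S : Set G) (x : G) : wdist S x x = 0 := by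
  have h : wordLength S (1 : G) = 0 := Nat.le_zero.mp (Nat.sInf_le ⟨[], by simp⟩)
  simp [wdist, h]

/-- Along a broken line with long segments and small Gromov products at the corners, the Gromov
product of the starting point and the next vertex, based at the current vertex, stays small. -/
theorem gromovProd_start_le {G : Type*} [Group G] {S : Set G} (hSsym : ∀ s ∈ S, s⁻¹ ∈ S)
    (hSgen : Subgroup.closure S = ⊤) {δ C : ℝ} (hC : 0 ≤ C + δ)
    (hhyp : ∀ x y z w : G,
      gromovProd S x y w ≥ min (gromovProd S x z w) (gromovProd S y z w) - δ)
    {n : ℕ} {X : ℕ → G} (hlong : ∀ i < n, wdist S (X i) (X (i + 1)) > 2 * (C + δ))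
    (hprod : ∀ i, i + 2 ≤ n → gromovProd S (X i) (X (i + 2)) (X (i + 1)) ≤ C)
    (k : ℕ) (hk : k < n) : gromovProd S (X 0) (X (k + 1)) (X k) ≤ C + δ := by
  induction k with
  | zero =>
    have h := wdist_comm hSsym hSgen (X 0) (X 1)
    simp only [gromovProd, wdist_self]
    linarith
  | succ k ih =>
    have hprev := ih (by omega)
    have hlen := hlong k (by omega)
    have hfour := hhyp (X k) (X (k + 2)) (X 0) (X (k + 1))
    have hcorner := hprod k (by omega)
    have hmin : min (gromovProd S (X k) (X 0) (X (k + 1)))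
        (gromovProd S (X (k + 2)) (X 0) (X (k + 1))) ≤ C + δ := by linarith
    have h₁ := wdist_comm hSsym hSgen (X k) (X 0)
    have h₂ := wdist_comm hSsym hSgen (X (k + 1)) (X k)
    have h₃ := wdist_comm hSsym hSgen (X (k + 2)) (X 0)
    rcases min_le_iff.mp hmin with h | h <;> simp only [gromovProd] at * <;> linarith

/-- Broken line lemma.  Let `G` be `δ`-hyperbolic, `C₀ ≥ 14δ`, `C₁ > 12(C₀ + δ)`, and let
`X 0, X 1, …, X n` satisfy `d(X (i-1), X i) > C₁` for `i = 1, …, n` and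
`(X (i-1) | X (i+1))_{X i} ≤ C₀` for `i = 1, …, n-1`.  Then
`d(X 0, X n) ≥ ½ ∑_{i=1}^{n} d(X (i-1), X i)`. -/
theorem broken_line_length_bound
    {G : Type*} [Group G] (S : Set G) (hSfin : S.Finite)
    (hSsym : ∀ s ∈ S, s⁻¹ ∈ S) (hSgen : Subgroup.closure S = ⊤)
    (δ : ℝ) (hδ : 0 ≤ δ) (hhyp : IsHyperbolicWith S δ)
    (C₀ C₁ : ℝ) (hC₀ : C₀ ≥ 14 * δ) (hC₁ : C₁ > 12 * (C₀ + δ))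
    (n : ℕ) (X : ℕ → G)
    (hlong : ∀ i < n, wdist S (X i) (X (i + 1)) > C₁)
    (hprod : ∀ i, i + 2 ≤ n → gromovProd S (X i) (X (i + 2)) (X (i + 1)) ≤ C₀) :
    wdist S (X 0) (X n) ≥ (∑ i ∈ Finset.range n, wdist S (X i) (X (i + 1))) / 2 := by
  have hC : 0 ≤ C₀ + δ := by linarith
  have key := gromovProd_start_le hSsym hSgen hC hhyp.1
    (fun i hi => by linarith [hlong i hi]) hprod
  suffices h : ∀ k ≤ n,
      wdist S (X 0) (X k) ≥ (∑ i ∈ Finset.range k, wdist S (X i) (X (i + 1))) / 2 from h n le_rfl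
  intro k
  induction k with
  | zero => simp [wdist_self]
  | succ k ih =>
    intro hk
    have hstart := ih (by omega)
    have hlen := hlong k hk
    have hsmall := key k hk
    have hcomm := wdist_comm hSsym hSgen (X (k + 1)) (X k)
    rw [Finset.sum_range_succ]
    simp only [gromovProd] at hsmall
    linarith
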